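/- arXiv:2501.04186 — 2 statements merged into one kernel-verified Lean document; each statement's English description precedes it below -/
import Mathlib

section
/- Let B₁ and B₂ be signed chord diagrams on chord sets E₁ and E₂. Suppose there is a bijection φ : E₁ → E₂ such that for all distinct e, e′ ∈ E₁, e and e′ are interlaced in B₁ if and only if φ(e) and φ(e′) are interlaced in B₂ (i.e. the intersection graphs I(B₁) and I(B₂) are isomorphic, with no condition on the signs). Then ∂ε^×_{B₁}(z) = ∂ε^×_{B₂}(z). -/
open Finset Polynomial

/-- A signed chord diagram (bouquet) on a finite chord set `E` with `n` chords:
the `2*n` cyclic positions are labeled by chords via `chord`, each chord occupying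
exactly two positions, and each chord carries a sign (`true` = `+1` = untwisted,
`false` = `-1` = twisted). -/
structure Bouquet (n : ℕ) (E : Type) [Fintype E] [DecidableEq E] where
  chord : Fin (2 * n) → E
  sign : E → Bool
  fiber_two : ∀ e : E, (Finset.univ.filter fun i => chord i = e).card = 2

namespace Bouquet

variable {n : ℕ} {E : Type} [Fintype E] [DecidableEq E]

/-- The partial Petrial `B^{×|A}`: same chord diagram, signs flipped exactly on `A`. -/
def petrial (B : Bouquet n E) (A : Finset E) : Bouquet n E where
  chord := B.chord
  sign := fun e => if e ∈ A then !B.sign e else B.sign e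
  fiber_two := B.fiber_two

/-- The boundary graph on the `4*n` points `(i, b)` (with `b = true` meaning `i⁺` and
`b = false` meaning `i⁻`): the matching `σ` joins `i⁺` to `(i+1)⁻`, and the matching `τ`
joins, for each chord with endpoints `{i, j}`, the points `i⁺,j⁻` and `i⁻,j⁺` when the
sign is `+1`, and the points `i⁺,j⁺` and `i⁻,j⁻` when the sign is `-1`. -/
def boundaryGraph (B : Bouquet n E) : SimpleGraph (Fin (2 * n) × Bool) :=
  SimpleGraph.fromRel fun x y =>
    (x.2 = true ∧ y.2 = false ∧ y.1.val = (x.1.val + 1) % (2 * n)) ∨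
    (B.chord x.1 = B.chord y.1 ∧ x.1 ≠ y.1 ∧
      (if B.sign (B.chord x.1) then x.2 ≠ y.2 else x.2 = y.2))

/-- `f(B)`: the number of boundary components of `B`, i.e. the number of connected
components of the boundary graph. -/
noncomputable def numBoundary (B : Bouquet n E) : ℕ :=
  Nat.card B.boundaryGraph.ConnectedComponent

/-- The Euler genus `ε(B) = n + 1 - f(B)`. -/
noncomputable def eulerGenus (B : Bouquet n E) : ℕ :=
  n + 1 - B.numBoundary

/-- The partial Petrial polynomial `∂ε^×_B(z) = Σ_{A ⊆ E} z^{ε(B^{×|A})}`. -/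
noncomputable def petrialPoly (B : Bouquet n E) : Polynomial ℤ :=
  ∑ A : Finset E, Polynomial.X ^ (B.petrial A).eulerGenus

/-- Two distinct chords are interlaced if exactly one endpoint of the second lies in
one of the two open arcs determined by the endpoints of the first (expressed here by
cutting the circle between positions `2*n - 1` and `0`). -/
def Interlaced (B : Bouquet n E) (e e' : E) : Prop :=
  e ≠ e' ∧ ∃ i j : Fin (2 * n), B.chord i = e ∧ B.chord j = e ∧ i < j ∧
    (Finset.univ.filter fun k => B.chord k = e' ∧ i < k ∧ k < j).card = 1

/-- The intersection graph `I(B)`: vertices are the chords, two chords adjacent iff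
interlaced. -/
def intersectionGraph (B : Bouquet n E) : SimpleGraph E :=
  SimpleGraph.fromRel B.Interlaced

end Bouquet

namespace Bouquet

variable {n : ℕ} {E : Type} [Fintype E] [DecidableEq E]

open scoped Classical in
/-- Membership in the kernel of the adjacency matrix over `ZMod 2` of the intersection graph,
with ones on the diagonal at the twisted chords. -/
def IsKernel (B : Bouquet n E) (z : E → ZMod 2) : Prop :=
  ∀ e, (∑ e', if B.Interlaced e e' then z e' else 0) + (if B.sign e then 0 else z e) = 0

/-- A function on the points that is constant on the boundary components. -/
def IsBoundaryConst (B : Bouquet n E) (x : Fin (2 * n) × Bool → ZMod 2) : Prop :=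
  ∀ p q, B.boundaryGraph.Adj p q → x p = x q

/-- The sum of the weights `z` over the positions before `m`. -/
def prefixSum (B : Bouquet n E) (z : E → ZMod 2) (m : ℕ) : ZMod 2 :=
  ∑ k : Fin (2 * n) with k.val < m, z (B.chord k)

theorem two_mul_eq_two_mul_card (B : Bouquet n E) : 2 * n = 2 * Fintype.card E := by
  have h := Finset.card_eq_sum_card_fiberwise (f := B.chord) (s := univ) (t := univ)
    (fun _ _ => by simp)
  simp only [B.fiber_two] at h
  simpa [mul_comm] using h

theorem prefixSum_zero (B : Bouquet n E) (z : E → ZMod 2) : B.prefixSum z 0 = 0 := by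
  simp [prefixSum]

theorem prefixSum_succ (B : Bouquet n E) (z : E → ZMod 2) (i : Fin (2 * n)) :
    B.prefixSum z (i + 1) = B.prefixSum z i + z (B.chord i) := by
  unfold prefixSum
  have : (univ.filter fun k : Fin (2 * n) => k.val < i.val + 1)
      = insert i (univ.filter fun k : Fin (2 * n) => k.val < i.val) := by
    ext k; simp [Fin.ext_iff]; omega
  rw [this, Finset.sum_insert (by simp), add_comm]

theorem prefixSum_total (B : Bouquet n E) (z : E → ZMod 2) : B.prefixSum z (2 * n) = 0 := by
  unfold prefixSum
  rw [Finset.filter_true_of_mem (fun k _ => k.isLt),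
    ← Finset.sum_fiberwise (s := univ) (g := B.chord)]
  refine Finset.sum_eq_zero fun e _ => ?_
  rw [Finset.sum_congr rfl (g := fun _ => z e) (fun k hk => by simp at hk; rw [hk]),
    Finset.sum_const, B.fiber_two, two_nsmul, CharTwo.add_self_eq_zero]

theorem fiber_eq_pair (B : Bouquet n E) {i j : Fin (2 * n)} (hij : i ≠ j)
    (h : B.chord i = B.chord j) :
    (univ.filter fun k => B.chord k = B.chord i) = {i, j} := by
  symm
  apply Finset.eq_of_subset_of_card_le
  · intro k hk
    simp only [mem_insert, mem_singleton] at hk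
    rcases hk with rfl | rfl <;> simp [h]
  · rw [B.fiber_two, Finset.card_pair hij]

theorem interlaced_iff (B : Bouquet n E) {i j : Fin (2 * n)} (hij : i < j)
    (h : B.chord i = B.chord j) (e' : E) :
    B.Interlaced (B.chord i) e' ↔ B.chord i ≠ e' ∧
      (univ.filter fun k => B.chord k = e' ∧ i < k ∧ k < j).card = 1 := by
  refine and_congr_right fun _ => ⟨?_, fun hc => ⟨i, j, rfl, h.symm, hij, hc⟩⟩
  rintro ⟨i', j', hi, hj, hij', hc⟩
  have key : ∀ k, B.chord k = B.chord i → k = i ∨ k = j := fun k hk => by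
    have : k ∈ univ.filter fun k => B.chord k = B.chord i := by simp [hk]
    simpa [B.fiber_eq_pair hij.ne h] using this
  have h1 := key _ hi
  have h2 := key _ hj
  obtain ⟨rfl, rfl⟩ : i' = i ∧ j' = j := by
    constructor <;> omega
  exact hc

open scoped Classical in
theorem sum_arc (B : Bouquet n E) (z : E → ZMod 2) {i j : Fin (2 * n)} (hij : i < j)
    (h : B.chord i = B.chord j) :
    ∑ k with i < k ∧ k < j, z (B.chord k)
      = ∑ e', if B.Interlaced (B.chord i) e' then z e' else 0 := by
  rw [← Finset.sum_fiberwise (s := univ.filter _) (g := B.chord)]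
  refine Finset.sum_congr rfl fun e' _ => ?_
  rw [Finset.sum_congr rfl (g := fun _ => z e') (fun k hk => by simp at hk; rw [hk.2]),
    Finset.sum_const, Finset.filter_filter, B.interlaced_iff hij h]
  have hcomm : (univ.filter fun k => (i < k ∧ k < j) ∧ B.chord k = e')
      = univ.filter fun k => B.chord k = e' ∧ i < k ∧ k < j := by
    ext k; simp only [mem_filter]; tauto
  rw [hcomm]
  by_cases he : B.chord i = e'
  · subst he
    have : (univ.filter fun k => B.chord k = B.chord i ∧ i < k ∧ k < j) = ∅ := by
      ext k
      simp only [mem_filter, mem_univ, true_and, notMem_empty, iff_false]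
      rintro ⟨hk, h1, h2⟩
      have : k ∈ univ.filter fun k => B.chord k = B.chord i := by simp [hk]
      rw [B.fiber_eq_pair hij.ne h, mem_insert, mem_singleton] at this
      rcases this with rfl | rfl
      · exact h1.false
      · exact h2.false
    simp [this]
  · have hle : (univ.filter fun k => B.chord k = e' ∧ i < k ∧ k < j).card ≤ 2 :=
      (Finset.card_le_card fun k hk => by simp at hk ⊢; exact hk.1).trans (B.fiber_two e').le
    generalize (univ.filter fun k => B.chord k = e' ∧ i < k ∧ k < j).card = c at hle ⊢
    interval_cases c
    · simp
    · simp [he]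
    · rw [two_nsmul, CharTwo.add_self_eq_zero, if_neg (by simp)]

open scoped Classical in
theorem prefixSum_arc (B : Bouquet n E) (z : E → ZMod 2) {i j : Fin (2 * n)} (hij : i < j)
    (h : B.chord i = B.chord j) :
    B.prefixSum z j = B.prefixSum z (i + 1)
      + ∑ e', if B.Interlaced (B.chord i) e' then z e' else 0 := by
  rw [← B.sum_arc z hij h]
  unfold prefixSum
  rw [← Finset.sum_union]
  · congr 1
    ext k; simp only [mem_filter, mem_union, mem_univ, true_and]; omega
  · rw [Finset.disjoint_left]
    intro k; simp only [mem_filter, mem_univ, true_and]; omega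

/-- The function on the points whose jump across each position is the weight of its chord. -/
def ofJump (B : Bouquet n E) (c : ZMod 2) (z : E → ZMod 2) (p : Fin (2 * n) × Bool) : ZMod 2 :=
  c + B.prefixSum z (if p.2 then p.1 + 1 else p.1)

theorem isBoundaryConst_iff (B : Bouquet n E) (x : Fin (2 * n) × Bool → ZMod 2) :
    B.IsBoundaryConst x ↔
      (∀ i j : Fin (2 * n), j.val = (i.val + 1) % (2 * n) → x (i, true) = x (j, false)) ∧
      ∀ i j : Fin (2 * n), i < j → B.chord i = B.chord j →
        if B.sign (B.chord i) then x (i, true) = x (j, false) ∧ x (i, false) = x (j, true)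
        else x (i, true) = x (j, true) ∧ x (i, false) = x (j, false) := by
  simp only [IsBoundaryConst, boundaryGraph, SimpleGraph.fromRel_adj]
  constructor
  · intro H
    refine ⟨fun i j hij => H _ _ ⟨by simp, Or.inl (Or.inl ⟨rfl, rfl, hij⟩)⟩,
      fun i j hij hc => ?_⟩
    split_ifs with hs
    · constructor <;>
        exact H _ _ ⟨by simp, Or.inl (Or.inr ⟨hc, hij.ne, by simp [hs]⟩)⟩
    · constructor <;>
        exact H _ _ ⟨by simp [hij.ne], Or.inl (Or.inr ⟨hc, hij.ne, by simp [hs]⟩)⟩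
  · rintro ⟨H1, H2⟩
    have T : ∀ p q : Fin (2 * n) × Bool, p.1 < q.1 → B.chord p.1 = B.chord q.1 →
        (if B.sign (B.chord p.1) then p.2 ≠ q.2 else p.2 = q.2) → x p = x q := by
      rintro ⟨i, a⟩ ⟨j, b⟩ hij hc hs
      have := H2 i j hij hc
      dsimp only at hs
      split_ifs at hs this <;> cases a <;> cases b <;> simp_all
    have R : ∀ p q : Fin (2 * n) × Bool,
        ((p.2 = true ∧ q.2 = false ∧ q.1.val = (p.1.val + 1) % (2 * n)) ∨
        (B.chord p.1 = B.chord q.1 ∧ p.1 ≠ q.1 ∧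
          (if B.sign (B.chord p.1) then p.2 ≠ q.2 else p.2 = q.2))) → x p = x q := by
      rintro p q (⟨hp, hq, hpq⟩ | ⟨hc, hne, hs⟩)
      · obtain ⟨i, a⟩ := p
        obtain ⟨j, b⟩ := q
        dsimp only at hp hq hpq
        subst hp hq
        exact H1 i j hpq
      · rcases lt_or_gt_of_ne hne with hlt | hlt
        · exact T p q hlt hc hs
        · refine (T q p hlt hc.symm ?_).symm
          rw [← hc]
          simpa only [ne_comm, eq_comm] using hs
    rintro p q ⟨-, h | h⟩
    · exact R p q h
    · exact (R q p h).symm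

theorem isBoundaryConst_ofJump_iff (B : Bouquet n E) (c : ZMod 2) (z : E → ZMod 2) :
    B.IsBoundaryConst (B.ofJump c z) ↔ B.IsKernel z := by
  have alg : ∀ c p a s : ZMod 2,
      ((c + (p + a) = c + (p + a + s) ∧ c + p = c + (p + a + s + a)) ↔ s = 0) ∧
      ((c + (p + a) = c + (p + a + s + a) ∧ c + p = c + (p + a + s)) ↔ s + a = 0) := by
    decide
  have H1 : ∀ i j : Fin (2 * n), j.val = (i.val + 1) % (2 * n) →
      B.ofJump c z (i, true) = B.ofJump c z (j, false) := by
    intro i j hij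
    simp only [ofJump, if_true, Bool.false_eq_true, if_false, hij]
    rcases Nat.lt_or_ge (i.val + 1) (2 * n) with hlt | hge
    · rw [Nat.mod_eq_of_lt hlt]
    · have : i.val + 1 = 2 * n := by omega
      rw [this, Nat.mod_self, prefixSum_zero, prefixSum_total]
  rw [isBoundaryConst_iff, and_iff_right H1]
  have key : ∀ i j : Fin (2 * n), i < j → B.chord i = B.chord j →
      ((if B.sign (B.chord i) then
          B.ofJump c z (i, true) = B.ofJump c z (j, false) ∧
          B.ofJump c z (i, false) = B.ofJump c z (j, true)
        else B.ofJump c z (i, true) = B.ofJump c z (j, true) ∧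
          B.ofJump c z (i, false) = B.ofJump c z (j, false)) ↔
      (∑ e', @ite _ (B.Interlaced (B.chord i) e') (Classical.propDecidable _) (z e') 0)
        + (if B.sign (B.chord i) then 0 else z (B.chord i)) = 0) := by
    intro i j hij hc
    simp only [ofJump, if_true, Bool.false_eq_true, if_false, prefixSum_succ,
      B.prefixSum_arc z hij hc, ← hc]
    split_ifs
    · rw [add_zero]; exact (alg _ _ _ _).1
    · exact (alg _ _ _ _).2
  constructor
  · intro H e
    obtain ⟨a, b, hab, hf⟩ := Finset.card_eq_two.mp (B.fiber_two e)
    have ha : B.chord a = e := by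
      have : a ∈ univ.filter fun i => B.chord i = e := by simp [hf]
      simpa using this
    have hb : B.chord b = e := by
      have : b ∈ univ.filter fun i => B.chord i = e := by simp [hf]
      simpa using this
    rcases lt_or_gt_of_ne hab with hlt | hlt
    · have := (key a b hlt (ha.trans hb.symm)).1 (H a b hlt (ha.trans hb.symm))
      rwa [ha] at this
    · have := (key b a hlt (hb.trans ha.symm)).1 (H b a hlt (hb.trans ha.symm))
      rwa [hb] at this
  · intro H i j hij hc
    exact (key i j hij hc).2 (H _)

theorem exists_eq_ofJump (B : Bouquet n E) (hn : 0 < n) {x : Fin (2 * n) × Bool → ZMod 2}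
    (hx : B.IsBoundaryConst x) : ∃ c z, x = B.ofJump c z := by
  obtain ⟨H1, H2⟩ := (B.isBoundaryConst_iff x).1 hx
  have hex : ∀ e, ∃ i, B.chord i = e := fun e => by
    have : (univ.filter fun i => B.chord i = e).Nonempty := by
      rw [← Finset.card_pos, B.fiber_two]; norm_num
    obtain ⟨i, hi⟩ := this
    exact ⟨i, by simpa using hi⟩
  choose r hr using hex
  have D1 : ∀ i j, i < j → B.chord i = B.chord j →
      x (i, true) + x (i, false) = x (j, true) + x (j, false) := by
    intro i j hij hc
    have := H2 i j hij hc
    split_ifs at this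
    · rw [this.1, this.2, add_comm]
    · rw [this.1, this.2]
  have D : ∀ i j, B.chord i = B.chord j →
      x (i, true) + x (i, false) = x (j, true) + x (j, false) := by
    intro i j hc
    rcases lt_trichotomy i j with h | rfl | h
    · exact D1 i j h hc
    · rfl
    · exact (D1 j i h hc.symm).symm
  let z : E → ZMod 2 := fun e => x (r e, true) + x (r e, false)
  have hz : ∀ i, x (i, true) = x (i, false) + z (B.chord i) := fun i => by
    have hd : z (B.chord i) = x (i, true) + x (i, false) := D _ _ (hr _)
    rw [hd, add_comm, add_assoc, CharTwo.add_self_eq_zero, add_zero]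
  have hlow : ∀ m (hm : m < 2 * n),
      x (⟨m, hm⟩, false) = x (⟨0, by omega⟩, false) + B.prefixSum z m := by
    intro m
    induction m with
    | zero => intro _; rw [prefixSum_zero, add_zero]
    | succ m ih =>
      intro hm
      have hm' : m < 2 * n := by omega
      rw [← H1 ⟨m, hm'⟩ ⟨m + 1, hm⟩ (Nat.mod_eq_of_lt hm).symm, hz, ih hm', add_assoc,
        ← B.prefixSum_succ z ⟨m, hm'⟩]
  refine ⟨x (⟨0, by omega⟩, false), z, funext ?_⟩
  rintro ⟨i, _ | _⟩
  · simpa [ofJump] using hlow i i.isLt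
  · simp only [ofJump, if_true]
    rw [prefixSum_succ, ← add_assoc, ← hlow i i.isLt]
    exact hz i

theorem ofJump_injective (B : Bouquet n E) (hn : 0 < n) :
    Function.Injective fun p : ZMod 2 × (E → ZMod 2) => B.ofJump p.1 p.2 := by
  rintro ⟨c, z⟩ ⟨d, w⟩ h
  have hc : c = d := by
    have := congrFun h (⟨0, by omega⟩, false)
    simpa [ofJump, prefixSum_zero] using this
  subst hc
  refine Prod.ext rfl (funext fun e => ?_)
  have hne : (univ.filter fun i => B.chord i = e).Nonempty := by
    rw [← Finset.card_pos, B.fiber_two]; norm_num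
  obtain ⟨i, hi⟩ := hne
  obtain rfl : B.chord i = e := by simpa using hi
  have h0 := congrFun h (i, false)
  have h1 := congrFun h (i, true)
  simp only [ofJump, if_true, Bool.false_eq_true, if_false, prefixSum_succ,
    add_right_inj] at h0 h1
  rw [h0] at h1
  exact add_left_cancel h1

theorem card_isBoundaryConst (B : Bouquet n E) :
    Nat.card {x // B.IsBoundaryConst x} = 2 ^ B.numBoundary := by
  have e : (B.boundaryGraph.ConnectedComponent → ZMod 2) ≃ {x // B.IsBoundaryConst x} := by
    refine Equiv.ofBijective (fun g => ⟨fun p => g (B.boundaryGraph.connectedComponentMk p),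
      fun p q h => congrArg g (SimpleGraph.ConnectedComponent.sound h.reachable)⟩) ⟨?_, ?_⟩
    · intro g g' h
      funext C
      induction C using SimpleGraph.ConnectedComponent.ind with
      | h p => exact congrFun (congrArg Subtype.val h) p
    · rintro ⟨x, hx⟩
      refine ⟨SimpleGraph.ConnectedComponent.lift x fun p q w _ => ?_, rfl⟩
      induction w with
      | nil => rfl
      | cons h w ih => exact (hx _ _ h).trans (ih (SimpleGraph.Walk.IsPath.of_cons ‹_›))
  rw [← Nat.card_congr e, Nat.card_fun, Nat.card_zmod, numBoundary]

/-- The corank formula for the number of boundary components. -/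
theorem two_pow_numBoundary (B : Bouquet n E) (hn : 0 < n) :
    2 ^ B.numBoundary = 2 * Nat.card {z // B.IsKernel z} := by
  have e : ZMod 2 × {z // B.IsKernel z} ≃ {x // B.IsBoundaryConst x} := by
    refine Equiv.ofBijective
      (fun p => ⟨B.ofJump p.1 p.2, (B.isBoundaryConst_ofJump_iff _ _).2 p.2.2⟩) ⟨?_, ?_⟩
    · rintro ⟨c, z, hz⟩ ⟨d, w, hw⟩ h
      have := B.ofJump_injective hn (a₁ := (c, z)) (a₂ := (d, w)) (congrArg Subtype.val h)
      simp_all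
    · rintro ⟨x, hx⟩
      obtain ⟨c, z, rfl⟩ := B.exists_eq_ofJump hn hx
      exact ⟨(c, ⟨z, (B.isBoundaryConst_ofJump_iff c z).1 hx⟩), rfl⟩
  rw [← card_isBoundaryConst, ← Nat.card_congr e, Nat.card_prod, Nat.card_zmod]

/-- The Euler genus depends only on the signed intersection graph. -/
theorem eulerGenus_congr {F : Type} [Fintype F] [DecidableEq F] (B : Bouquet n E)
    (C : Bouquet n F) (φ : E ≃ F)
    (hint : ∀ e e', e ≠ e' → (B.Interlaced e e' ↔ C.Interlaced (φ e) (φ e')))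
    (hsign : ∀ e, B.sign e = C.sign (φ e)) : B.eulerGenus = C.eulerGenus := by
  unfold eulerGenus
  congr 1
  rcases Nat.eq_zero_or_pos n with rfl | hn
  · have empty : ∀ G : SimpleGraph (Fin (2 * 0) × Bool), Nat.card G.ConnectedComponent = 0 := by
      intro G
      have : IsEmpty G.ConnectedComponent :=
        ⟨fun c => c.ind fun p => absurd p.1.isLt (by simp)⟩
      exact Nat.card_of_isEmpty
    rw [numBoundary, numBoundary, empty, empty]
  · apply Nat.pow_right_injective le_rfl
    dsimp only
    rw [B.two_pow_numBoundary hn, C.two_pow_numBoundary hn]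
    congr 1
    have hint' : ∀ e e', B.Interlaced e e' ↔ C.Interlaced (φ e) (φ e') := fun e e' => by
      by_cases h : e = e'
      · subst h
        exact iff_of_false (fun h => h.1 rfl) (fun h => h.1 rfl)
      · exact hint e e' h
    refine Nat.card_congr ((φ.arrowCongr (Equiv.refl _)).subtypeEquiv fun z => ?_)
    classical
    unfold IsKernel
    rw [← φ.forall_congr_right]
    refine forall_congr' fun e => ?_
    rw [← φ.sum_comp, ← hsign,
      Finset.sum_congr rfl fun e' _ => if_congr (hint' e e') (rfl : z e' = z e') rfl]
    simp

end Bouquet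

/-- Two bouquets with the same (unsigned) intersection graph have the same partial
Petrial polynomial. -/
theorem stmt2 {n₁ n₂ : ℕ} {E₁ E₂ : Type}
    [Fintype E₁] [DecidableEq E₁] [Fintype E₂] [DecidableEq E₂]
    (B₁ : Bouquet n₁ E₁) (B₂ : Bouquet n₂ E₂) (φ : E₁ ≃ E₂)
    (hint : ∀ e e' : E₁, e ≠ e' → (B₁.Interlaced e e' ↔ B₂.Interlaced (φ e) (φ e'))) :
    B₁.petrialPoly = B₂.petrialPoly := by
  obtain rfl : n₁ = n₂ := by
    have h₁ := B₁.two_mul_eq_two_mul_card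
    have h₂ := B₂.two_mul_eq_two_mul_card
    have := Fintype.card_congr φ
    omega
  let D : Finset E₁ := univ.filter fun e => B₁.sign e ≠ B₂.sign (φ e)
  let ψ : Finset E₁ ≃ Finset E₂ :=
    (Function.Involutive.toPerm (fun A => symmDiff A D) fun A =>
      symmDiff_symmDiff_cancel_right D A).trans φ.finsetCongr
  unfold Bouquet.petrialPoly
  refine Fintype.sum_equiv ψ _ _ fun A => ?_
  congr 1
  refine Bouquet.eulerGenus_congr _ _ φ hint fun e => ?_
  have hmem : φ e ∈ ψ A ↔ e ∈ symmDiff A D := by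
    simp [ψ]
    rfl
  simp only [Bouquet.petrial, hmem, Finset.mem_symmDiff, D, mem_filter, mem_univ, true_and]
  by_cases hA : e ∈ A <;> cases B₁.sign e <;> cases B₂.sign (φ e) <;> simp [hA]
end

section
/- Let B be a signed chord diagram on n ≥ 1 chords with f(B) > 1. Then there exists a chord e of B such that f(B^{×|{e}}) = f(B) − 1. -/
open Finset Polynomial

/-- If `H` has the same reachability as `G` except that the components of `a` and `a'` are merged,
then `H` has one component less than `G`. -/
theorem SimpleGraph.card_connectedComponent_of_merge {V : Type*} [Finite V] {G H : SimpleGraph V}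
    {a a' : V} (hne : ¬ G.Reachable a a')
    (hGH : ∀ x y, G.Adj x y → H.Reachable x y)
    (hHG : ∀ x y, H.Adj x y → G.Reachable x y ∨ (G.Reachable a x ∧ G.Reachable a' y) ∨
      (G.Reachable a' x ∧ G.Reachable a y))
    (haa' : H.Reachable a a') :
    Nat.card H.ConnectedComponent = Nat.card G.ConnectedComponent - 1 := by
  classical
  have hreach : ∀ x y, G.Reachable x y → H.Reachable x y := by
    rintro x y ⟨p⟩
    induction p with
    | nil => rfl
    | cons h _ ih => exact (hGH _ _ h).trans ih
  have hne' : G.connectedComponentMk a ≠ G.connectedComponentMk a' := fun h =>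
    hne (SimpleGraph.ConnectedComponent.eq.mp h)
  let ψ : V → {c : G.ConnectedComponent // c ≠ G.connectedComponentMk a'} := fun x =>
    if h : G.connectedComponentMk x = G.connectedComponentMk a' then
      ⟨G.connectedComponentMk a, hne'⟩ else ⟨G.connectedComponentMk x, h⟩
  have hψ_pos : ∀ x, G.Reachable a' x → ψ x = ⟨G.connectedComponentMk a, hne'⟩ := fun x h =>
    dif_pos (SimpleGraph.ConnectedComponent.sound h.symm)
  have hψ_neg : ∀ x (h : G.connectedComponentMk x ≠ G.connectedComponentMk a'),
      ψ x = ⟨G.connectedComponentMk x, h⟩ := fun x h => dif_neg h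
  have hψ_left : ∀ x, G.Reachable a x → ψ x = ⟨G.connectedComponentMk a, hne'⟩ := fun x h => by
    have hx := SimpleGraph.ConnectedComponent.sound h
    rw [hψ_neg x (hx ▸ hne')]
    exact Subtype.ext hx.symm
  have hψ : ∀ x y, H.Adj x y → ψ x = ψ y := by
    intro x y hxy
    rcases hHG x y hxy with h | ⟨h₁, h₂⟩ | ⟨h₁, h₂⟩
    · simp only [ψ, SimpleGraph.ConnectedComponent.sound h]
    · rw [hψ_left x h₁, hψ_pos y h₂]
    · rw [hψ_pos x h₁, hψ_left y h₂]
  have hψ' : ∀ x y (p : H.Walk x y), p.IsPath → ψ x = ψ y := by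
    intro x y p _
    induction p with
    | nil => rfl
    | cons h _ ih => exact (hψ _ _ h).trans (ih (by simp_all))
  let φ : G.ConnectedComponent → H.ConnectedComponent :=
    SimpleGraph.ConnectedComponent.lift H.connectedComponentMk
      fun x y p _ => SimpleGraph.ConnectedComponent.sound (hreach x y ⟨p⟩)
  let e : H.ConnectedComponent ≃ {c : G.ConnectedComponent // c ≠ G.connectedComponentMk a'} :=
    { toFun := SimpleGraph.ConnectedComponent.lift ψ hψ'
      invFun := fun c => φ c.1
      left_inv := by
        intro c
        induction c using SimpleGraph.ConnectedComponent.ind with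
        | h x =>
          by_cases h : G.connectedComponentMk x = G.connectedComponentMk a'
          · have hx := hreach _ _ (SimpleGraph.ConnectedComponent.eq.mp h)
            rw [SimpleGraph.ConnectedComponent.lift_mk,
              hψ_pos x (SimpleGraph.ConnectedComponent.eq.mp h).symm]
            exact SimpleGraph.ConnectedComponent.sound (haa'.trans hx.symm)
          · rw [SimpleGraph.ConnectedComponent.lift_mk, hψ_neg x h]
            rfl
      right_inv := by
        rintro ⟨c, hc⟩
        induction c using SimpleGraph.ConnectedComponent.ind with
        | h x => exact hψ_neg x hc }
  have := Fintype.ofFinite G.ConnectedComponent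
  rw [Nat.card_congr e, Nat.card_eq_fintype_card, Nat.card_eq_fintype_card]
  simp [Fintype.card_subtype_compl]

theorem Finset.even_card_of_involution {V : Type*} (X : Finset V) (σ : V → V)
    (hmem : ∀ x ∈ X, σ x ∈ X) (hne : ∀ x, σ x ≠ x) (hinv : ∀ x, σ (σ x) = x) :
    Even X.card := by
  have h : ∑ _x ∈ X, (1 : ZMod 2) = 0 :=
    Finset.sum_involution (fun x _ => σ x) (fun _ _ => by decide) (fun x _ _ => hne x)
      hmem (fun x _ => hinv x)
  rw [Finset.sum_const, nsmul_one, ZMod.natCast_eq_zero_iff_even] at h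
  exact h

/-- The union of two perfect matchings `σ` and `τ`, with the edges of `τ` inside the `τ`-stable
set `S` removed, joins `a ∈ S` to `τ a` unless it joins `a` to a third point of `S`. -/
theorem SimpleGraph.reachable_matching_of_removed {V : Type*} [Finite V] {K : SimpleGraph V}
    {σ τ : V → V} {S : Set V}
    (hσ : ∀ x, σ x ≠ x) (hσσ : ∀ x, σ (σ x) = x) (hτ : ∀ x, τ x ≠ x) (hττ : ∀ x, τ (τ x) = x)
    (hτS : ∀ x ∉ S, τ x ∉ S) (hKσ : ∀ x, K.Adj x (σ x)) (hKτ : ∀ x ∉ S, K.Adj x (τ x))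
    {a : V} (ha : a ∈ S) (hS : ∀ s ∈ S, K.Reachable a s → s = a ∨ s = τ a) :
    K.Reachable a (τ a) := by
  classical
  have := Fintype.ofFinite V
  by_contra hcon
  let X : Finset V := Finset.univ.filter fun x => K.Reachable a x
  have h₁ : Even X.card := X.even_card_of_involution σ
    (fun x hx => by
      simp only [X, Finset.mem_filter_univ] at hx ⊢
      exact hx.trans (hKσ x).reachable) hσ hσσ
  have h₂ : Even (X.filter fun x => x ∉ S).card :=
    Finset.even_card_of_involution _ τ
      (fun x hx => by
        simp only [X, Finset.mem_filter, Finset.mem_univ, true_and] at hx ⊢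
        exact ⟨hx.1.trans (hKτ x hx.2).reachable, hτS x hx.2⟩) hτ hττ
  have h₃ : X.filter (fun x => x ∈ S) = {a} := by
    ext s
    simp only [X, Finset.mem_filter, Finset.mem_univ, true_and, Finset.mem_singleton]
    constructor
    · rintro ⟨hs, hsS⟩
      rcases hS s hsS hs with h | h
      · exact h
      · exact absurd (h ▸ hs) hcon
    · rintro rfl
      exact ⟨by rfl, ha⟩
  have h₄ := Finset.card_filter_add_card_filter_not (s := X) (fun x => x ∈ S)
  rw [h₃, Finset.card_singleton] at h₄
  rw [← h₄] at h₁
  obtain ⟨k, hk⟩ := h₁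
  obtain ⟨l, hl⟩ := h₂
  omega

namespace Bouquet

variable {n : ℕ} {E : Type} [Fintype E] [DecidableEq E]

theorem exists_mate (B : Bouquet n E) :
    ∃ m : Fin (2 * n) → Fin (2 * n), (∀ i, m i ≠ i) ∧ (∀ i, m (m i) = i) ∧
      ∀ i k, B.chord k = B.chord i ↔ k = i ∨ k = m i := by
  have h : ∀ i, ∃ j, j ≠ i ∧ ∀ k, B.chord k = B.chord i ↔ k = i ∨ k = j := by
    intro i
    obtain ⟨x, y, hxy, hF⟩ := Finset.card_eq_two.mp (B.fiber_two (B.chord i))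
    have hk : ∀ k, B.chord k = B.chord i ↔ k = x ∨ k = y := fun k => by
      simpa using Finset.ext_iff.mp hF k
    rcases (hk i).mp rfl with rfl | rfl
    · exact ⟨y, hxy.symm, hk⟩
    · exact ⟨x, hxy, fun k => (hk k).trans or_comm⟩
  choose m hne hm using h
  refine ⟨m, hne, fun i => ?_, hm⟩
  have h₁ : B.chord (m i) = B.chord i := (hm i _).mpr (Or.inr rfl)
  exact (((hm (m i) i).mp h₁.symm).resolve_left (hne i).symm).symm

/-- The matching joining `i⁺` to `(i+1)⁻`. -/
def arc [NeZero (2 * n)] (x : Fin (2 * n) × Bool) : Fin (2 * n) × Bool :=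
  if x.2 then (x.1 + 1, false) else (x.1 - 1, true)

/-- The matching given by the sides of the chords, where `m` exchanges the two endpoints of each
chord. -/
def side (B : Bouquet n E) (m : Fin (2 * n) → Fin (2 * n)) (x : Fin (2 * n) × Bool) :
    Fin (2 * n) × Bool :=
  (m x.1, x.2 ^^ B.sign (B.chord x.1))

theorem arc_ne [NeZero (2 * n)] (x : Fin (2 * n) × Bool) : arc x ≠ x := by
  obtain ⟨i, _ | _⟩ := x <;> simp [arc]

theorem arc_arc [NeZero (2 * n)] (x : Fin (2 * n) × Bool) : arc (arc x) = x := by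
  obtain ⟨i, _ | _⟩ := x <;> simp [arc]

theorem boundaryGraph_adj_iff [NeZero (2 * n)] (B : Bouquet n E) {m : Fin (2 * n) → Fin (2 * n)}
    (hne : ∀ i, m i ≠ i)
    (hm : ∀ i k, B.chord k = B.chord i ↔ k = i ∨ k = m i) (x y : Fin (2 * n) × Bool) :
    B.boundaryGraph.Adj x y ↔ y = arc x ∨ y = B.side m x := by
  have hval : ∀ i j : Fin (2 * n), j.val = (i.val + 1) % (2 * n) ↔ j = i + 1 := by
    intro i j
    rw [Fin.ext_iff, Fin.val_add, Fin.val_one', Nat.add_mod_mod]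
  have hchord : ∀ i j, (B.chord i = B.chord j ∧ i ≠ j) ↔ j = m i := by
    intro i j
    rw [eq_comm, hm]
    have := hne i
    grind
  have hside : ∀ x y : Fin (2 * n) × Bool, (B.chord x.1 = B.chord y.1 ∧ x.1 ≠ y.1 ∧
      (if B.sign (B.chord x.1) then x.2 ≠ y.2 else x.2 = y.2)) ↔ y = B.side m x := by
    rintro ⟨i, b⟩ ⟨j, c⟩
    rw [← and_assoc, hchord]
    simp only [side, Prod.mk.injEq]
    refine and_congr_right fun _ => ?_
    cases B.sign (B.chord i) <;> cases b <;> cases c <;> simp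
  have hsymm : ∀ x y : Fin (2 * n) × Bool, x = B.side m y → y = B.side m x := by
    rintro x y h
    rw [← hside] at h ⊢
    refine ⟨h.1.symm, h.2.1.symm, ?_⟩
    rw [← h.1]
    simpa only [ne_comm, eq_comm] using h.2.2
  simp only [boundaryGraph, SimpleGraph.fromRel_adj, hside, hval]
  have harc : ((x.2 = true ∧ y.2 = false ∧ y.1 = x.1 + 1) ∨
      (y.2 = true ∧ x.2 = false ∧ x.1 = y.1 + 1)) ↔ y = arc x := by
    obtain ⟨i, _ | _⟩ := x <;> obtain ⟨j, _ | _⟩ := y <;> simp [arc, eq_sub_iff_add_eq, eq_comm]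
  have hsx : B.side m x ≠ x := fun h => hne x.1 (congrArg Prod.fst h)
  have hax := arc_ne x
  have := hsymm x y
  have := hsymm y x
  grind

theorem exists_not_reachable (B : Bouquet n E) (hf : 1 < B.numBoundary) :
    ∃ i, ¬ B.boundaryGraph.Reachable (i, true) (i, false) := by
  by_contra! hall
  have hmain : ∀ k (hk : k < 2 * n), B.boundaryGraph.Reachable (⟨k, hk⟩, false)
      (⟨0, by omega⟩, false) := by
    intro k
    induction k with
    | zero => intro _; rfl
    | succ k ih =>
      intro hk
      refine SimpleGraph.Reachable.trans ?_ ((hall ⟨k, by omega⟩).trans (ih (by omega)))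
      apply SimpleGraph.Adj.reachable
      simp [boundaryGraph, Nat.mod_eq_of_lt hk]
  have hb : ∀ x : Fin (2 * n) × Bool, B.boundaryGraph.Reachable x (x.1, false) := by
    rintro ⟨i, _ | _⟩
    · rfl
    · exact hall i
  have := Finite.one_lt_card_iff_nontrivial.mp hf
  obtain ⟨c, d, hcd⟩ := exists_pair_ne B.boundaryGraph.ConnectedComponent
  induction c using SimpleGraph.ConnectedComponent.ind with | h x =>
  induction d using SimpleGraph.ConnectedComponent.ind with | h y =>
  exact hcd (SimpleGraph.ConnectedComponent.sound <|
    ((hb x).trans (hmain _ x.1.2)).trans ((hb y).trans (hmain _ y.1.2)).symm)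

theorem numBoundary_petrial_of_not_reachable [NeZero (2 * n)] (B : Bouquet n E) (i : Fin (2 * n))
    (hi : ¬ B.boundaryGraph.Reachable (i, true) (i, false)) :
    (B.petrial {B.chord i}).numBoundary = B.numBoundary - 1 := by
  obtain ⟨m, hne, hmm, hm⟩ := B.exists_mate
  have hG := B.boundaryGraph_adj_iff hne hm
  have hH := (B.petrial {B.chord i}).boundaryGraph_adj_iff hne hm
  have hcm : ∀ j, B.chord (m j) = B.chord j := fun j => (hm _ _).mpr (Or.inr rfl)
  set G := B.boundaryGraph
  set H := (B.petrial {B.chord i}).boundaryGraph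
  let τ := B.side m
  let τ' := (B.petrial {B.chord i}).side m
  have hτ : ∀ x, τ x ≠ x := fun x h => hne x.1 (congrArg Prod.fst h)
  have hττ : ∀ x, τ (τ x) = x := fun x => by simp [τ, side, hmm, hcm]
  let S : Set (Fin (2 * n) × Bool) := {x | B.chord x.1 = B.chord i}
  let a : Fin (2 * n) × Bool := (i, true)
  let a' : Fin (2 * n) × Bool := (i, false)
  have hSmem : ∀ s ∈ S, s = a ∨ s = a' ∨ s = τ a ∨ s = τ a' := by
    rintro ⟨j, b⟩ hs
    rcases (hm i j).mp hs with h | h <;> subst j <;> cases b <;> cases h : B.sign (B.chord i) <;>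
      simp [a, a', τ, side, h]
  have hτ' : ∀ x ∉ S, τ' x = τ x := fun x hx => by
    have : B.chord x.1 ≠ B.chord i := hx
    simp [τ, τ', side, petrial, this]
  have e₁ : τ' a = τ a' := by
    cases h : B.sign (B.chord i) <;> simp [a, a', τ, τ', side, petrial, h]
  have e₂ : τ' a' = τ a := by
    cases h : B.sign (B.chord i) <;> simp [a, a', τ, τ', side, petrial, h]
  have e₃ : τ' (τ a) = a' := by
    cases h : B.sign (B.chord i) <;> simp [a, a', τ, τ', side, petrial, h, hcm, hmm]
  have e₄ : τ' (τ a') = a := by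
    cases h : B.sign (B.chord i) <;> simp [a, a', τ, τ', side, petrial, h, hcm, hmm]
  let K := G ⊓ H
  have hKG : ∀ {x y}, K.Reachable x y → G.Reachable x y := fun h => h.mono inf_le_left
  have hKH : ∀ {x y}, K.Reachable x y → H.Reachable x y := fun h => h.mono inf_le_right
  have hKσ : ∀ x, K.Adj x (arc x) := fun x =>
    ⟨(hG _ _).mpr (Or.inl rfl), (hH _ _).mpr (Or.inl rfl)⟩
  have hKτ : ∀ x ∉ S, K.Adj x (τ x) := fun x hx =>
    ⟨(hG _ _).mpr (Or.inr rfl), (hH _ _).mpr (Or.inr (hτ' x hx).symm)⟩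
  have hτS : ∀ x ∉ S, τ x ∉ S := fun x hx => by
    simpa [S, τ, side, hcm] using hx
  have hGτ : ∀ x, G.Reachable x (τ x) := fun x => ((hG _ _).mpr (Or.inr rfl)).reachable
  have hHτ : ∀ x, H.Reachable x (τ' x) := fun x => ((hH _ _).mpr (Or.inr rfl)).reachable
  have ha : K.Reachable a (τ a) := by
    refine SimpleGraph.reachable_matching_of_removed arc_ne arc_arc hτ hττ hτS hKσ hKτ
      (S := S) rfl fun s hs hr => ?_
    rcases hSmem s hs with h | rfl | h | rfl
    · exact Or.inl h
    · exact absurd (hKG hr) hi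
    · exact Or.inr h
    · exact absurd ((hKG hr).trans (hGτ a').symm) hi
  have ha' : K.Reachable a' (τ a') := by
    refine SimpleGraph.reachable_matching_of_removed arc_ne arc_arc hτ hττ hτS hKσ hKτ
      (S := S) rfl fun s hs hr => ?_
    rcases hSmem s hs with rfl | h | rfl | h
    · exact absurd (hKG hr).symm hi
    · exact Or.inl h
    · exact absurd ((hGτ a).trans (hKG hr).symm) hi
    · exact Or.inr h
  refine SimpleGraph.card_connectedComponent_of_merge (a := a) (a' := a') hi ?_ ?_ ?_
  · intro x y hxy
    rcases (hG x y).mp hxy with rfl | rfl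
    · exact hKH (hKσ x).reachable
    · by_cases hx : x ∈ S
      · change H.Reachable x (τ x)
        rcases hSmem x hx with rfl | rfl | rfl | rfl
        · exact hKH ha
        · exact hKH ha'
        · rw [hττ]; exact (hKH ha).symm
        · rw [hττ]; exact (hKH ha').symm
      · exact hKH (hKτ x hx).reachable
  · intro x y hxy
    rcases (hH x y).mp hxy with rfl | rfl
    · exact Or.inl (hKG (hKσ x).reachable)
    · change G.Reachable x (τ' x) ∨ (G.Reachable a x ∧ G.Reachable a' (τ' x)) ∨
        (G.Reachable a' x ∧ G.Reachable a (τ' x))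
      by_cases hx : x ∈ S
      · right
        rcases hSmem x hx with rfl | rfl | rfl | rfl
        · rw [e₁]; exact Or.inl ⟨by rfl, hGτ a'⟩
        · rw [e₂]; exact Or.inr ⟨by rfl, hGτ a⟩
        · rw [e₃]; exact Or.inl ⟨hGτ a, by rfl⟩
        · rw [e₄]; exact Or.inr ⟨hGτ a', by rfl⟩
      · rw [hτ' x hx]
        exact Or.inl (hGτ x)
  · have h := hHτ a
    rw [e₁] at h
    exact h.trans (hKH ha').symm

end Bouquet

/-- If a bouquet on `n ≥ 1` chords has more than one boundary component, then adding a
half-twist to some single chord decreases the number of boundary components by one. -/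
theorem stmt4 {n : ℕ} (hn : 1 ≤ n) {E : Type} [Fintype E] [DecidableEq E]
    (B : Bouquet n E) (hf : 1 < B.numBoundary) :
    ∃ e : E, (B.petrial {e}).numBoundary = B.numBoundary - 1 := by
  have : NeZero (2 * n) := ⟨by omega⟩
  obtain ⟨i, hi⟩ := B.exists_not_reachable hf
  exact ⟨B.chord i, B.numBoundary_petrial_of_not_reachable i hi⟩
end
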